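/- Let γ > 1, and let u_1, …, u_s be unit vectors in ℝⁿ and c_1, …, c_s > 0 satisfy I_n ⪯ A := Σ_{j=1}^s c_j u_j ⊗ u_j ⪯ γ I_n. Set κ_j = c_j ⟨A^{-1} u_j, u_j⟩ > 0 for 1 ≤ j ≤ s. Then for all λ_1, …, λ_s > 0 one has γⁿ · det(Σ_{j=1}^s κ_j λ_j u_j ⊗ u_j) ≥ Π_{j=1}^s λ_j^{κ_j}. -/

import Mathlib

open scoped Matrix

open Matrix in
/-- Congruence transforms a weighted sum of rank-one matrices vector by vector. -/
theorem mul_sum_vecMulVec_mul_transpose {m ι : Type*} [Fintype m] [Fintype ι]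
    (M : Matrix m m ℝ) (a : ι → ℝ) (u : ι → m → ℝ) :
    M * (∑ j, a j • vecMulVec (u j) (u j)) * Mᵀ =
      ∑ j, a j • vecMulVec (M *ᵥ u j) (M *ᵥ u j) := by
  simp [Finset.mul_sum, Finset.sum_mul, mul_vecMulVec, vecMulVec_mul, vecMul_transpose]

open Matrix in
theorem isHermitian_sum_smul_vecMulVec {m ι : Type*} [Fintype ι]
    (a : ι → ℝ) (u : ι → m → ℝ) :
    (∑ j, a j • vecMulVec (u j) (u j)).IsHermitian := by
  simp [IsHermitian, transpose_sum, transpose_vecMulVec]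

open Matrix in
/-- Ball's determinant inequality when the weighted sum is diagonal. -/
theorem prod_rpow_le_prod_of_sum_eq_diagonal {m ι : Type*} [Fintype m] [DecidableEq m]
    [Fintype ι] (c lam : ι → ℝ) (hc : ∀ j, 0 ≤ c j) (hlam : ∀ j, 0 < lam j)
    (z : ι → m → ℝ) (d : m → ℝ)
    (h1 : ∑ j, c j • vecMulVec (z j) (z j) = 1)
    (hd : ∑ j, (c j * lam j) • vecMulVec (z j) (z j) = diagonal d) :
    ∏ j, lam j ^ (c j * (z j ⬝ᵥ z j)) ≤ ∏ i, d i := by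
  have hrow (i : m) : ∏ j, lam j ^ (c j * (z j i * z j i)) ≤ d i := by
    have e1 := congrFun (congrFun h1 i) i
    have e2 := congrFun (congrFun hd i) i
    simp only [Matrix.sum_apply, Matrix.smul_apply, vecMulVec_apply, smul_eq_mul,
      Matrix.one_apply_eq, Matrix.diagonal_apply_eq] at e1 e2
    refine (Real.geom_mean_le_arith_mean_weighted Finset.univ _ _
      (fun j _ => mul_nonneg (hc j) (mul_self_nonneg _)) e1 (fun j _ => (hlam j).le)).trans_eq ?_
    rw [← e2]
    exact Finset.sum_congr rfl fun j _ => by ring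
  calc ∏ j, lam j ^ (c j * (z j ⬝ᵥ z j))
      = ∏ i, ∏ j, lam j ^ (c j * (z j i * z j i)) := by
        rw [Finset.prod_comm]
        refine Finset.prod_congr rfl fun j _ => ?_
        rw [← Real.rpow_sum_of_pos (hlam j), dotProduct, Finset.mul_sum]
    _ ≤ ∏ i, d i := Finset.prod_le_prod
        (fun i _ => Finset.prod_nonneg fun j _ => Real.rpow_nonneg (hlam j).le _)
        fun i _ => hrow i

open Matrix in
/-- Ball's determinant inequality for a decomposition of the identity. -/
theorem prod_rpow_le_det_of_sum_eq_one {m ι : Type*} [Fintype m] [DecidableEq m]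
    [Fintype ι] (c lam : ι → ℝ) (hc : ∀ j, 0 ≤ c j) (hlam : ∀ j, 0 < lam j)
    (w : ι → m → ℝ) (h1 : ∑ j, c j • vecMulVec (w j) (w j) = 1) :
    ∏ j, lam j ^ (c j * (w j ⬝ᵥ w j)) ≤
      (∑ j, (c j * lam j) • vecMulVec (w j) (w j)).det := by
  have hM := isHermitian_sum_smul_vecMulVec (fun j => c j * lam j) w
  set M := ∑ j, (c j * lam j) • vecMulVec (w j) (w j) with hMdef
  let U : Matrix m m ℝ := (hM.eigenvectorUnitary).1
  have hUt : Uᵀ = star U := by simp [star_eq_conjTranspose]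
  have hUU : Uᵀ * U = 1 := by rw [hUt]; exact Unitary.coe_star_mul_self _
  have hUU' : U * Uᵀ = 1 := by rw [hUt]; exact Unitary.coe_mul_star_self _
  have hdiag : Uᵀ * M * Uᵀᵀ = diagonal hM.eigenvalues := by
    have := hM.conjStarAlgAut_star_eigenvectorUnitary
    rw [Unitary.conjStarAlgAut_star_apply] at this
    rw [transpose_transpose, hUt]
    exact this
  have key := prod_rpow_le_prod_of_sum_eq_diagonal c lam hc hlam (fun j => Uᵀ *ᵥ w j)
    hM.eigenvalues
    (by rw [← mul_sum_vecMulVec_mul_transpose, h1, mul_one, transpose_transpose, hUU])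
    (by rw [← mul_sum_vecMulVec_mul_transpose, ← hMdef, hdiag])
  have hdot (j : ι) : (Uᵀ *ᵥ w j) ⬝ᵥ (Uᵀ *ᵥ w j) = w j ⬝ᵥ w j := by
    rw [dotProduct_mulVec, vecMul_transpose, mulVec_mulVec, hUU', one_mulVec]
  simp only [hdot] at key
  rw [hM.det_eq_prod_eigenvalues]
  simpa using key

open Matrix in
/-- Ball's determinant inequality for a decomposition of a positive definite matrix. -/
theorem det_mul_prod_rpow_le_det {m ι : Type*} [Fintype m] [DecidableEq m]
    [Fintype ι] (c lam : ι → ℝ) (hc : ∀ j, 0 ≤ c j) (hlam : ∀ j, 0 < lam j)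
    (u : ι → m → ℝ) (A : Matrix m m ℝ) (hpd : A.PosDef)
    (hA : A = ∑ j, c j • vecMulVec (u j) (u j)) :
    A.det * ∏ j, lam j ^ (c j * (A⁻¹ *ᵥ u j ⬝ᵥ u j)) ≤
      (∑ j, (c j * lam j) • vecMulVec (u j) (u j)).det := by
  obtain ⟨B, hB⟩ : ∃ B : Matrix m m ℝ, A = Bᵀ * B := by
    open scoped MatrixOrder Matrix.Norms.L2Operator in
    obtain ⟨B, hB⟩ := CStarAlgebra.nonneg_iff_eq_star_mul_self.mp hpd.posSemidef.nonneg
    exact ⟨B, by simpa [star_eq_conjTranspose] using hB⟩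
  have hdet : A.det = B.det * B.det := by rw [hB, det_mul, det_transpose]
  have hBdet : B.det ≠ 0 := fun h => hpd.det_pos.ne' (by rw [hdet, h, zero_mul])
  have hBu : IsUnit B.det := hBdet.isUnit
  have hPA : (B⁻¹)ᵀ * A * (B⁻¹)ᵀᵀ = 1 := by
    rw [transpose_transpose, hB, ← mul_assoc, ← transpose_mul, mul_nonsing_inv _ hBu,
      transpose_one, one_mul, mul_nonsing_inv _ hBu]
  have hdot (j : ι) : ((B⁻¹)ᵀ *ᵥ u j) ⬝ᵥ ((B⁻¹)ᵀ *ᵥ u j) = A⁻¹ *ᵥ u j ⬝ᵥ u j := by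
    rw [dotProduct_mulVec, vecMul_transpose, mulVec_mulVec, hB, Matrix.mul_inv_rev, transpose_nonsing_inv]
  have key := prod_rpow_le_det_of_sum_eq_one c lam hc hlam (fun j => (B⁻¹)ᵀ *ᵥ u j)
    (by rw [← mul_sum_vecMulVec_mul_transpose, ← hA, hPA])
  rw [← mul_sum_vecMulVec_mul_transpose] at key
  simp only [hdot, det_mul, det_transpose, det_nonsing_inv, Ring.inverse_eq_inv'] at key
  refine (mul_le_mul_of_nonneg_left key hpd.det_pos.le).trans_eq ?_
  rw [hdet]
  field_simp

open Matrix in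
/-- A symmetric matrix dominating the identity has determinant at least one. -/
theorem one_le_det_of_dotProduct_le {m : Type*} [Fintype m] [DecidableEq m]
    {A : Matrix m m ℝ} (hA : A.IsHermitian) (h : ∀ x : m → ℝ, x ⬝ᵥ x ≤ x ⬝ᵥ A *ᵥ x) :
    1 ≤ A.det := by
  rw [hA.det_eq_prod_eigenvalues]
  refine Finset.one_le_prod fun i _ => ?_
  have hnorm : hA.eigenvectorBasis i ⬝ᵥ hA.eigenvectorBasis i = (1 : ℝ) := by
    have := hA.eigenvectorBasis.inner_eq_one i
    rwa [EuclideanSpace.inner_eq_star_dotProduct, star_trivial] at this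
  have := h (hA.eigenvectorBasis i)
  rw [hA.mulVec_eigenvectorBasis, dotProduct_smul, hnorm] at this
  simpa using this

open Matrix in
/-- If `0 ⪯ A ⪯ γ I` and `A` is invertible, then `⟨u, u⟩ ≤ γ ⟨A⁻¹ u, u⟩`. -/
theorem dotProduct_self_le_mul_inv_mulVec {m : Type*} [Fintype m] [DecidableEq m]
    {A : Matrix m m ℝ} (hpd : A.PosDef) {γ : ℝ} (hγ : 0 < γ)
    (h : ∀ x : m → ℝ, x ⬝ᵥ A *ᵥ x ≤ γ * (x ⬝ᵥ x)) (u : m → ℝ) :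
    u ⬝ᵥ u ≤ γ * (A⁻¹ *ᵥ u ⬝ᵥ u) := by
  have hu : IsUnit A.det := hpd.det_pos.ne'.isUnit
  set y := A⁻¹ *ᵥ u with hy
  have hAy : A *ᵥ y = u := by rw [hy, mulVec_mulVec, mul_nonsing_inv _ hu, one_mulVec]
  have hsymm : y ⬝ᵥ A *ᵥ u = u ⬝ᵥ u := by
    have hAt : Aᵀ = A := by simpa using hpd.isHermitian.eq
    rw [dotProduct_mulVec, ← mulVec_transpose, hAt, hAy]
  have hnn := hpd.posSemidef.dotProduct_mulVec_nonneg (γ • y - u)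
  simp only [star_trivial, mulVec_sub, mulVec_smul, hAy, sub_dotProduct, dotProduct_sub,
    smul_dotProduct, dotProduct_smul, smul_eq_mul, hsymm] at hnn
  have := h u
  refine le_of_mul_le_mul_left ?_ hγ
  linarith

/-- If unit vectors `uⱼ` and weights `cⱼ > 0` satisfy `I_n ⪯ A := Σ cⱼ uⱼ ⊗ uⱼ ⪯ γ I_n`
and `κⱼ = cⱼ ⟨A⁻¹ uⱼ, uⱼ⟩`, then for all `λⱼ > 0` one has
`γⁿ · det(Σ κⱼ λⱼ uⱼ ⊗ uⱼ) ≥ Π λⱼ^{κⱼ}`. -/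
theorem det_lower_bound_approx_john (n s : ℕ) (γ : ℝ) (hγ : 1 < γ)
    (u : Fin s → Fin n → ℝ) (hu : ∀ j, u j ⬝ᵥ u j = 1)
    (c : Fin s → ℝ) (hc : ∀ j, 0 < c j)
    (A : Matrix (Fin n) (Fin n) ℝ)
    (hA : A = ∑ j, c j • Matrix.vecMulVec (u j) (u j))
    (hA1 : ∀ x : Fin n → ℝ, x ⬝ᵥ x ≤ x ⬝ᵥ A.mulVec x)
    (hA2 : ∀ x : Fin n → ℝ, x ⬝ᵥ A.mulVec x ≤ γ * (x ⬝ᵥ x))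
    (κ : Fin s → ℝ) (hκ : ∀ j, κ j = c j * (A⁻¹.mulVec (u j) ⬝ᵥ u j))
    (lam : Fin s → ℝ) (hlam : ∀ j, 0 < lam j) :
    ∏ j, lam j ^ κ j ≤
      γ ^ n * (∑ j, (κ j * lam j) • Matrix.vecMulVec (u j) (u j)).det := by
  have hγ0 : 0 < γ := zero_lt_one.trans hγ
  have hherm : A.IsHermitian := hA ▸ isHermitian_sum_smul_vecMulVec c u
  have hpd : A.PosDef := Matrix.PosDef.of_dotProduct_mulVec_pos hherm fun x hx =>
    (Matrix.dotProduct_star_self_pos_iff.mpr hx).trans_le (by simpa using hA1 x)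
  have ht (j : Fin s) : 1 ≤ γ * (A⁻¹.mulVec (u j) ⬝ᵥ u j) :=
    hu j ▸ dotProduct_self_le_mul_inv_mulVec hpd hγ0 hA2 (u j)
  have hκ0 (j : Fin s) : 0 ≤ κ j := by
    rw [hκ]
    exact mul_nonneg (hc j).le (pos_of_mul_pos_right (zero_lt_one.trans_le (ht j)) hγ0.le).le
  set lam' : Fin s → ℝ := fun j => γ * (A⁻¹.mulVec (u j) ⬝ᵥ u j) * lam j with hlam'
  have hle (j : Fin s) : lam j ≤ lam' j := le_mul_of_one_le_left (hlam j).le (ht j)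
  have key := det_mul_prod_rpow_le_det c lam' (fun j => (hc j).le)
    (fun j => (hlam j).trans_le (hle j)) u A hpd hA
  simp only [← hκ] at key
  have hsum : ∑ j, (c j * lam' j) • Matrix.vecMulVec (u j) (u j) =
      γ • ∑ j, (κ j * lam j) • Matrix.vecMulVec (u j) (u j) := by
    rw [Finset.smul_sum]
    refine Finset.sum_congr rfl fun j _ => ?_
    rw [smul_smul, hκ, hlam']
    congr 1
    ring
  rw [hsum, Matrix.det_smul, Fintype.card_fin] at key
  calc ∏ j, lam j ^ κ j ≤ ∏ j, lam' j ^ κ j :=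
        Finset.prod_le_prod (fun j _ => Real.rpow_nonneg (hlam j).le _)
          fun j _ => Real.rpow_le_rpow (hlam j).le (hle j) (hκ0 j)
    _ ≤ A.det * ∏ j, lam' j ^ κ j := le_mul_of_one_le_left
        (Finset.prod_nonneg fun j _ => Real.rpow_nonneg ((hlam j).le.trans (hle j)) _)
        (one_le_det_of_dotProduct_le hherm hA1)
    _ ≤ _ := key
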